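/- arXiv:2310.05454 — 4 statements merged into one kernel-verified Lean document; each statement's English description precedes it below -/
import Mathlib

section
/- A total order ≤ on A^∞ is a cylinder order if and only if the following holds: for all a, b, a′, b′ ∈ A^∞, if a ≤ b, d(a,a′) < d(a,b) and d(b,b′) < d(a,b), then a′ ≤ b′. -/
open scoped Classical

noncomputable section

/-- The ultrametric on infinite words: `d(a,b) = 2^{-min{n ≥ 1 : a_n ≠ b_n}}`
(words are indexed from 0 here, so position `i` corresponds to `n = i+1`). -/
noncomputable def wdist {A : Type*} [DecidableEq A] (a b : ℕ → A) : ℝ :=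
  if h : ∃ n, a n ≠ b n then (2 : ℝ)⁻¹ ^ (Nat.find h + 1) else 0

/-- The tail `a_{k+1} a_{k+2} ⋯` of an infinite word. -/
def shiftn {A : Type*} (a : ℕ → A) (k : ℕ) : ℕ → A := fun n => a (n + k)

/-- The set of tails of an infinite word (including the word itself). -/
def tails {A : Type*} (a : ℕ → A) : Set (ℕ → A) := {b | ∃ k, b = shiftn a k}

/-- A cylinder order: a total order such that `a ≤ b ≤ c` implies `d(a,b) ≤ d(a,c)`. -/
def IsCylOrder {A : Type*} [DecidableEq A] (le : (ℕ → A) → (ℕ → A) → Prop) : Prop :=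
  (∀ a b, le a b ∨ le b a) ∧
  (∀ a b, le a b → le b a → a = b) ∧
  (∀ a b c, le a b → le b c → le a c) ∧
  (∀ a b c, le a b → le b c → wdist a b ≤ wdist a c)

/-- Strict comparison associated to an order relation. -/
def wlt {A : Type*} (le : (ℕ → A) → (ℕ → A) → Prop) (a b : ℕ → A) : Prop :=
  le a b ∧ a ≠ b

/-- `m` is the least upper bound of the set `s` with respect to `le`. -/
def IsSupOf {A : Type*} (le : (ℕ → A) → (ℕ → A) → Prop) (s : Set (ℕ → A))
    (m : ℕ → A) : Prop :=
  (∀ x ∈ s, le x m) ∧ ∀ b, (∀ x ∈ s, le x b) → le m b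

/-- The set `M_≤ = {s_≤(a) : a ∈ A^∞}` of sup-words. -/
def supWords {A : Type*} (le : (ℕ → A) → (ℕ → A) → Prop) : Set (ℕ → A) :=
  {m | ∃ a, IsSupOf le (tails a) m}

/-- `x` is an accumulation point of `M` in the metric `wdist`. -/
def IsAccPt' {A : Type*} [DecidableEq A] (M : Set (ℕ → A)) (x : ℕ → A) : Prop :=
  ∀ ε : ℝ, 0 < ε → ∃ y ∈ M, y ≠ x ∧ wdist x y < ε

/-- `x` is the smallest (w.r.t. `le`) accumulation point of `M`. -/
def IsSmallestAcc {A : Type*} [DecidableEq A] (le : (ℕ → A) → (ℕ → A) → Prop)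
    (M : Set (ℕ → A)) (x : ℕ → A) : Prop :=
  IsAccPt' M x ∧ ∀ y, IsAccPt' M y → le x y

/-- Membership in the cylinder given by the finite word `w`. -/
def inCyl {A : Type*} (w : List A) (a : ℕ → A) : Prop :=
  ∀ i : Fin w.length, a i.val = w.get i

/-- `[u] < [v]` for cylinders: every element of `[u]` is strictly below every element of `[v]`. -/
def cylLt {A : Type*} (le : (ℕ → A) → (ℕ → A) → Prop) (u v : List A) : Prop :=
  ∀ a b, inCyl u a → inCyl v b → wlt le a b

theorem wdist_self {A : Type*} [DecidableEq A] (a : ℕ → A) : wdist a a = 0 := by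
  simp [wdist]

theorem wdist_nonneg {A : Type*} [DecidableEq A] (a b : ℕ → A) : 0 ≤ wdist a b := by
  unfold wdist
  split_ifs <;> positivity

theorem pow_le_wdist_of_ne {A : Type*} [DecidableEq A] {a b : ℕ → A} {n : ℕ}
    (h : a n ≠ b n) : (2 : ℝ)⁻¹ ^ (n + 1) ≤ wdist a b := by
  have hex : ∃ n, a n ≠ b n := ⟨n, h⟩
  rw [wdist, dif_pos hex]
  exact pow_le_pow_of_le_one (by norm_num) (by norm_num)
    (Nat.succ_le_succ (Nat.find_min' hex h))

theorem wdist_le_of_forall_ne {A : Type*} [DecidableEq A] {a b : ℕ → A} {r : ℝ} (hr : 0 ≤ r)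
    (h : ∀ n, a n ≠ b n → (2 : ℝ)⁻¹ ^ (n + 1) ≤ r) : wdist a b ≤ r := by
  unfold wdist
  split_ifs with hex
  · exact h _ (Nat.find_spec hex)
  · exact hr

theorem wdist_comm {A : Type*} [DecidableEq A] (a b : ℕ → A) : wdist a b = wdist b a :=
  le_antisymm
    (wdist_le_of_forall_ne (wdist_nonneg b a) fun _ h => pow_le_wdist_of_ne h.symm)
    (wdist_le_of_forall_ne (wdist_nonneg a b) fun _ h => pow_le_wdist_of_ne h.symm)

theorem wdist_le_max {A : Type*} [DecidableEq A] (a b c : ℕ → A) :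
    wdist a c ≤ max (wdist a b) (wdist b c) := by
  refine wdist_le_of_forall_ne (le_max_of_le_left (wdist_nonneg a b)) fun n h => ?_
  by_cases hab : a n = b n
  · exact le_max_of_le_right (pow_le_wdist_of_ne (hab ▸ h))
  · exact le_max_of_le_left (pow_le_wdist_of_ne hab)

theorem wdist_le_of_wdist_lt {A : Type*} [DecidableEq A] {a b c : ℕ → A}
    (h : wdist b c < wdist a b) : wdist a b ≤ wdist a c := by
  rcases le_max_iff.1 (wdist_le_max a c b) with h' | h'
  · exact h'
  · rw [wdist_comm c b] at h'
    exact absurd h (not_lt.2 h')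

/-- A total order `≤` on `A^∞` is a cylinder order if and only if:
for all `a, b, a', b'`, if `a ≤ b`, `d(a,a') < d(a,b)` and `d(b,b') < d(a,b)`,
then `a' ≤ b'`. -/
theorem stmt_0 {A : Type*} [Fintype A] [DecidableEq A]
    (le : (ℕ → A) → (ℕ → A) → Prop)
    (htotal : ∀ a b, le a b ∨ le b a)
    (hantisymm : ∀ a b, le a b → le b a → a = b)
    (htrans : ∀ a b c, le a b → le b c → le a c) :
    (∀ a b c, le a b → le b c → wdist a b ≤ wdist a c) ↔
      (∀ a b a' b', le a b → wdist a a' < wdist a b → wdist b b' < wdist a b →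
        le a' b') := by
  constructor
  · intro hcyl a b a' b' hab ha hb
    have hab' : wdist a b ≤ wdist a b' := wdist_le_of_wdist_lt hb
    have le_ab' : le a b' := by
      refine (htotal a b').resolve_right fun h => ?_
      have := hcyl b' a b h hab
      rw [wdist_comm b' a, wdist_comm b' b] at this
      linarith
    refine (htotal a' b').resolve_right fun h => ?_
    have := hcyl a b' a' le_ab' h
    linarith
  · intro hsep a b c hab hbc
    by_contra! hlt
    have hle : wdist a b ≤ wdist b c := by
      rw [wdist_comm a b] at hlt ⊢
      exact wdist_le_of_wdist_lt hlt
    have hba : le b a := by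
      refine hsep b c b a hbc ?_ ?_
      · rw [wdist_self]
        linarith [wdist_nonneg a c]
      · rw [wdist_comm c a]
        linarith
    rw [hantisymm a b hab hba, wdist_self] at hlt
    exact absurd hlt (not_lt.2 (wdist_nonneg b c))
end
end

section
/- For every cylinder order ≤ on A^∞, M_≤ equals the topological closure in the metric space (A^∞, d) of the set {s_≤(a) : a ∈ A^∞ purely periodic}; in particular, M_≤ is a closed subset of (A^∞, d). Here a is purely periodic if a = (a_1⋯a_p)^∞ for some p ≥ 1. -/
open scoped Classical

noncomputable section

/-- A word is purely periodic if it equals `(a_1 ⋯ a_p)^∞` for some `p ≥ 1`. -/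
def PurelyPeriodic {A : Type*} (a : ℕ → A) : Prop := ∃ p : ℕ, 0 < p ∧ ∀ n, a (n + p) = a n

/-- Topological closure of a set of infinite words with respect to the metric `wdist`. -/
def wClosure {A : Type*} [DecidableEq A] (S : Set (ℕ → A)) : Set (ℕ → A) :=
  {x | ∀ ε : ℝ, 0 < ε → ∃ y ∈ S, wdist x y < ε}

/-- Two infinite words have the same prefix of length `n`. -/
def AgreeUpTo {A : Type*} (n : ℕ) (a b : ℕ → A) : Prop := ∀ i < n, a i = b i

namespace AgreeUpTo

variable {A : Type*} {m n : ℕ} {a b c : ℕ → A}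

lemma refl (n : ℕ) (a : ℕ → A) : AgreeUpTo n a a := fun _ _ => rfl

lemma symm (h : AgreeUpTo n a b) : AgreeUpTo n b a := fun i hi => (h i hi).symm

lemma trans (h : AgreeUpTo n a b) (h' : AgreeUpTo n b c) : AgreeUpTo n a c :=
  fun i hi => (h i hi).trans (h' i hi)

lemma mono (hmn : m ≤ n) (h : AgreeUpTo n a b) : AgreeUpTo m a b :=
  fun i hi => h i (hi.trans_le hmn)

lemma shiftn {k : ℕ} (h : AgreeUpTo (n + k) a b) :
    AgreeUpTo n (shiftn a k) (shiftn b k) :=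
  fun i hi => h (i + k) (by omega)

end AgreeUpTo

lemma exists_not_agreeUpTo {A : Type*} {a b : ℕ → A} (h : a ≠ b) :
    ∃ n, ¬ AgreeUpTo n a b := by
  obtain ⟨i, hi⟩ := Function.ne_iff.mp h
  exact ⟨i + 1, fun H => hi (H i (by omega))⟩

lemma shiftn_shiftn {A : Type*} (a : ℕ → A) (j k : ℕ) :
    shiftn (shiftn a j) k = shiftn a (k + j) := by
  funext i
  simp only [shiftn]
  congr 1
  omega

lemma shiftn_mem_tails {A : Type*} (a : ℕ → A) (k : ℕ) : shiftn a k ∈ tails a := ⟨k, rfl⟩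

lemma self_mem_tails {A : Type*} (a : ℕ → A) : a ∈ tails a := shiftn_mem_tails a 0

lemma wdist_le_iff_agreeUpTo {A : Type*} [DecidableEq A] {a b : ℕ → A} {n : ℕ} :
    wdist a b ≤ (2 : ℝ)⁻¹ ^ (n + 1) ↔ AgreeUpTo n a b := by
  unfold wdist
  split_ifs with h
  · rw [pow_le_pow_iff_right_of_lt_one₀ (by norm_num) (by norm_num), Nat.add_le_add_iff_right,
      Nat.le_find_iff]
    simp [AgreeUpTo]
  · push Not at h
    exact ⟨fun _ i _ => h i, fun _ => by positivity⟩

lemma mem_wClosure_iff {A : Type*} [DecidableEq A] {S : Set (ℕ → A)} {x : ℕ → A} :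
    x ∈ wClosure S ↔ ∀ n, ∃ y ∈ S, AgreeUpTo n x y := by
  constructor
  · intro hx n
    obtain ⟨y, hy, hxy⟩ := hx ((2 : ℝ)⁻¹ ^ (n + 1)) (by positivity)
    exact ⟨y, hy, wdist_le_iff_agreeUpTo.mp hxy.le⟩
  · intro hx ε hε
    obtain ⟨n, hn⟩ := exists_pow_lt_of_lt_one hε (show (2 : ℝ)⁻¹ < 1 by norm_num)
    obtain ⟨y, hy, hxy⟩ := hx n
    refine ⟨y, hy, (wdist_le_iff_agreeUpTo.mpr hxy).trans_lt (lt_of_le_of_lt ?_ hn)⟩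
    exact pow_le_pow_of_le_one (by norm_num) (by norm_num) (Nat.le_succ n)

lemma subset_wClosure {A : Type*} [DecidableEq A] (S : Set (ℕ → A)) : S ⊆ wClosure S :=
  fun x hx => mem_wClosure_iff.mpr fun n => ⟨x, hx, AgreeUpTo.refl n x⟩

lemma wClosure_mono {A : Type*} [DecidableEq A] {S T : Set (ℕ → A)} (h : S ⊆ T) :
    wClosure S ⊆ wClosure T := fun _ hx ε hε =>
  let ⟨y, hy, hxy⟩ := hx ε hε
  ⟨y, h hy, hxy⟩

namespace IsCylOrder

variable {A : Type*} [DecidableEq A] {le : (ℕ → A) → (ℕ → A) → Prop}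

lemma total (h : IsCylOrder le) (a b : ℕ → A) : le a b ∨ le b a := h.1 a b

lemma refl (h : IsCylOrder le) (a : ℕ → A) : le a a := (h.total a a).elim id id

lemma antisymm (h : IsCylOrder le) {a b : ℕ → A} (hab : le a b) (hba : le b a) : a = b :=
  h.2.1 a b hab hba

lemma trans (h : IsCylOrder le) {a b c : ℕ → A} (hab : le a b) (hbc : le b c) : le a c :=
  h.2.2.1 a b c hab hbc

lemma agreeUpTo_of_le_of_le (h : IsCylOrder le) {n : ℕ} {a b c : ℕ → A} (hab : le a b)
    (hbc : le b c) (hac : AgreeUpTo n a c) : AgreeUpTo n a b :=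
  wdist_le_iff_agreeUpTo.mp
    ((h.2.2.2 a b c hab hbc).trans (wdist_le_iff_agreeUpTo.mpr hac))

/-- Distinct cylinders of the same depth are comparable as sets. -/
lemma le_congr (h : IsCylOrder le) {n : ℕ} {a b a' b' : ℕ → A} (hab : le a b)
    (hn : ¬ AgreeUpTo n a b) (ha : AgreeUpTo n a a') (hb : AgreeUpTo n b b') : le a' b' := by
  have h1 : le a' b := (h.total a' b).resolve_right fun H =>
    hn (h.agreeUpTo_of_le_of_le hab H ha)
  refine (h.total a' b').resolve_right fun H => hn ?_
  exact ha.trans ((h.agreeUpTo_of_le_of_le H h1 hb.symm).symm.trans hb.symm)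

lemma exists_greatest_of_finite (h : IsCylOrder le) {s : Set (ℕ → A)} (hs : s.Finite)
    (hne : s.Nonempty) : ∃ m ∈ s, ∀ x ∈ s, le x m := by
  induction s, hs using Set.Finite.induction_on with
  | empty => exact absurd hne Set.not_nonempty_empty
  | @insert a s _ _ ih =>
    rcases s.eq_empty_or_nonempty with rfl | hs
    · exact ⟨a, by simp, by simpa using h.refl a⟩
    · obtain ⟨m, hm, hmax⟩ := ih hs
      rcases h.total a m with ham | hma
      · refine ⟨m, Set.mem_insert_of_mem _ hm, ?_⟩
        rintro x (rfl | hx)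
        exacts [ham, hmax x hx]
      · refine ⟨a, Set.mem_insert _ _, ?_⟩
        rintro x (rfl | hx)
        exacts [h.refl x, h.trans (hmax x hx) hma]

lemma exists_greatest_prefix [Finite A] (h : IsCylOrder le) {S : Set (ℕ → A)}
    (hS : S.Nonempty) (n : ℕ) : ∃ m ∈ S, ∀ x ∈ S, AgreeUpTo n x m ∨ le x m := by
  let pre : S → (Fin n → A) := fun x i => x.1 i
  let rep : Set.range pre → (ℕ → A) := fun p => (p.2.choose : S).1
  have hrep : ∀ x : S, AgreeUpTo n x.1 (rep ⟨pre x, x, rfl⟩) := fun x i hi =>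
    (congrFun (Set.mem_range_self (f := pre) x).choose_spec ⟨i, hi⟩).symm
  obtain ⟨x₀, hx₀⟩ := hS
  obtain ⟨m, ⟨p, rfl⟩, hmax⟩ := h.exists_greatest_of_finite (Set.finite_range rep)
    ⟨_, ⟨pre ⟨x₀, hx₀⟩, ⟨x₀, hx₀⟩, rfl⟩, rfl⟩
  refine ⟨rep p, (p.2.choose : S).2, fun x hx => ?_⟩
  have hx' := hrep ⟨x, hx⟩
  by_cases hn : AgreeUpTo n x (rep p)
  · exact Or.inl hn
  · exact Or.inr (h.le_congr (hmax _ ⟨_, rfl⟩) (fun H => hn (hx'.trans H)) hx'.symm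
      (AgreeUpTo.refl n _))

lemma isSupOf_of_agreeUpTo (h : IsCylOrder le) {S : Set (ℕ → A)} {m : ℕ → A}
    (hub : ∀ x ∈ S, le x m) (happ : ∀ n, ∃ x ∈ S, AgreeUpTo n x m) : IsSupOf le S m := by
  refine ⟨hub, fun b hb => ?_⟩
  by_contra hmb
  have hbm := (h.total m b).resolve_left hmb
  have hne : b ≠ m := by
    rintro rfl
    exact hmb hbm
  obtain ⟨n, hn⟩ := exists_not_agreeUpTo hne
  obtain ⟨x, hx, hxm⟩ := happ n
  have hbx := h.antisymm (h.le_congr hbm hn (AgreeUpTo.refl n b) hxm.symm) (hb x hx)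
  exact hn (hbx ▸ hxm)

lemma exists_isSupOf [Finite A] (h : IsCylOrder le) {S : Set (ℕ → A)} (hS : S.Nonempty) :
    ∃ m, IsSupOf le S m ∧ ∀ n, ∃ x ∈ S, AgreeUpTo n x m := by
  let _ : TopologicalSpace A := ⊥
  have _ : DiscreteTopology A := ⟨rfl⟩
  let K : ℕ → Set (ℕ → A) := fun n =>
    {m | (∃ x ∈ S, AgreeUpTo n x m) ∧ ∀ x ∈ S, AgreeUpTo n x m ∨ le x m}
  have hcongr : ∀ n m m', AgreeUpTo n m m' → m ∈ K n → m' ∈ K n := by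
    rintro n m m' hm ⟨⟨x, hx, hxm⟩, hle⟩
    refine ⟨⟨x, hx, hxm.trans hm⟩, fun y hy => ?_⟩
    by_cases hn : AgreeUpTo n y m
    · exact Or.inl (hn.trans hm)
    · exact Or.inr (h.le_congr ((hle y hy).resolve_left hn) hn (AgreeUpTo.refl n y) hm)
  have hclosed : ∀ n, IsClosed (K n) := by
    intro n
    have hpre : K n = (fun (m : ℕ → A) (i : Fin n) => m i) ⁻¹'
        ((fun (m : ℕ → A) (i : Fin n) => m i) '' K n) := by
      refine (Set.subset_preimage_image _ _).antisymm ?_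
      rintro m ⟨m', hm', hmm'⟩
      exact hcongr n m' m (fun i hi => congrFun hmm' ⟨i, hi⟩) hm'
    rw [hpre]
    exact (isClosed_discrete _).preimage (by fun_prop)
  obtain ⟨m, hm⟩ := IsCompact.nonempty_iInter_of_sequence_nonempty_isCompact_isClosed K
    (fun n m ⟨⟨x, hx, hxm⟩, hle⟩ => ⟨⟨x, hx, hxm.mono n.le_succ⟩,
      fun y hy => (hle y hy).imp_left (AgreeUpTo.mono n.le_succ)⟩)
    (fun n => by
      obtain ⟨m, hm, hmax⟩ := h.exists_greatest_prefix hS n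
      exact ⟨m, ⟨m, hm, AgreeUpTo.refl n m⟩, hmax⟩)
    (hclosed 0).isCompact hclosed
  rw [Set.mem_iInter] at hm
  refine ⟨m, h.isSupOf_of_agreeUpTo (fun x hx => ?_) fun n => (hm n).1, fun n => (hm n).1⟩
  by_cases hxm : x = m
  · exact hxm ▸ h.refl x
  · obtain ⟨n, hn⟩ := exists_not_agreeUpTo hxm
    exact ((hm n).2 x hx).resolve_left hn

/-- A supremum is approximated by elements of the set. -/
lemma exists_agreeUpTo_of_isSupOf [Finite A] (h : IsCylOrder le) {S : Set (ℕ → A)}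
    (hS : S.Nonempty) {m : ℕ → A} (hm : IsSupOf le S m) (n : ℕ) :
    ∃ x ∈ S, AgreeUpTo n x m := by
  obtain ⟨m', hm', happ⟩ := h.exists_isSupOf hS
  obtain rfl : m = m' := h.antisymm (hm.2 m' hm'.1) (hm'.2 m hm.1)
  exact happ n

/-- Words approximated by words dominating their own tails dominate their own tails. -/
lemma shiftn_le_of_forall_agreeUpTo (h : IsCylOrder le) {m : ℕ → A} {k : ℕ}
    (happ : ∀ n, ∃ x y, AgreeUpTo n x m ∧ AgreeUpTo n y m ∧ le (shiftn x k) y) :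
    le (shiftn m k) m := by
  by_contra hnot
  have hlt := (h.total _ _).resolve_left hnot
  have hne : m ≠ shiftn m k := fun heq => hnot (heq ▸ hlt)
  obtain ⟨n, hn⟩ := exists_not_agreeUpTo hne
  obtain ⟨x, y, hx, hy, hxy⟩ := happ (n + k)
  have hy' := hy.mono (Nat.le_add_right n k)
  have hyx := h.le_congr hlt hn hy'.symm hx.symm.shiftn
  exact hn (hy'.symm.trans (h.antisymm hyx hxy ▸ hx.shiftn))

/-- Sup-words are exactly the words dominating all their tails. -/
lemma mem_supWords_iff [Finite A] (h : IsCylOrder le) {m : ℕ → A} :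
    m ∈ supWords le ↔ ∀ k, le (shiftn m k) m := by
  constructor
  · rintro ⟨a, ha⟩ k
    refine h.shiftn_le_of_forall_agreeUpTo fun n => ?_
    obtain ⟨x, ⟨j, rfl⟩, hx⟩ := h.exists_agreeUpTo_of_isSupOf ⟨a, self_mem_tails a⟩ ha n
    exact ⟨_, m, hx, AgreeUpTo.refl n m,
      shiftn_shiftn a j k ▸ ha.1 _ (shiftn_mem_tails a (k + j))⟩
  · intro hm
    refine ⟨m, ?_, fun b hb => hb m (self_mem_tails m)⟩
    rintro x ⟨k, rfl⟩
    exact hm k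

lemma wClosure_supWords [Finite A] (h : IsCylOrder le) :
    wClosure (supWords le) = supWords le := by
  refine Set.Subset.antisymm (fun x hx => ?_) (subset_wClosure _)
  rw [mem_wClosure_iff] at hx
  refine h.mem_supWords_iff.mpr fun k => h.shiftn_le_of_forall_agreeUpTo fun n => ?_
  obtain ⟨y, hy, hxy⟩ := hx n
  exact ⟨y, y, hxy.symm, hxy.symm, h.mem_supWords_iff.mp hy k⟩

/-- The periodic word obtained from the least period of a prefix of a sup-word has all its tails
bounded by that prefix. -/
lemma exists_purelyPeriodic (h : IsCylOrder le) {m : ℕ → A}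
    (hm : ∀ k, le (shiftn m k) m) (n : ℕ) :
    ∃ a, PurelyPeriodic a ∧ AgreeUpTo n a m ∧
      ∀ k, AgreeUpTo n (shiftn a k) m ∨ le (shiftn a k) m := by
  have hex : ∃ q, 0 < q ∧ ∀ i, i + q < n → m (i + q) = m i :=
    ⟨n + 1, n.succ_pos, fun i hi => by omega⟩
  obtain ⟨hq, hper⟩ := Nat.find_spec hex
  have hmin : ∀ {j}, j < Nat.find hex → _ := fun {j} hj => Nat.find_min hex hj
  generalize Nat.find hex = q at hq hper hmin
  have ham : ∀ i < n, m (i % q) = m i := by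
    intro i
    induction i using Nat.strong_induction_on with
    | _ i ih =>
      intro hi
      rcases lt_or_ge i q with hiq | hiq
      · rw [Nat.mod_eq_of_lt hiq]
      · have := hper (i - q) (by omega)
        rw [Nat.sub_add_cancel hiq] at this
        rw [this, Nat.mod_eq_sub_mod hiq]
        exact ih (i - q) (by omega) (by omega)
  refine ⟨fun i => m (i % q), ⟨q, hq, fun i => by simp⟩, ham, fun k => ?_⟩
  have hred : shiftn (fun i => m (i % q)) k = shiftn (fun i => m (i % q)) (k % q) := by
    funext i
    simp [shiftn]
  rw [hred]
  have hk : k % q < q := Nat.mod_lt _ hq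
  generalize k % q = j at hk
  rcases Nat.eq_zero_or_pos j with rfl | hj
  · exact Or.inl ham
  · right
    have hj' := hmin hk
    push Not at hj'
    obtain ⟨i, hi, hne⟩ := hj' hj
    refine h.le_congr (n := n - j) (hm j) (fun H => hne (H i (by omega))) ?_
      (AgreeUpTo.refl _ m)
    exact AgreeUpTo.shiftn fun l hl => (ham l (by omega)).symm

lemma supWords_subset_wClosure [Finite A] (h : IsCylOrder le) :
    supWords le ⊆ wClosure {m | ∃ a, PurelyPeriodic a ∧ IsSupOf le (tails a) m} := by
  intro m hm
  refine mem_wClosure_iff.mpr fun n => ?_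
  obtain ⟨a, hper, ham, htails⟩ := h.exists_purelyPeriodic (h.mem_supWords_iff.mp hm) n
  obtain ⟨s, hs, happ⟩ := h.exists_isSupOf ⟨a, self_mem_tails a⟩
  refine ⟨s, ⟨a, hper, hs⟩, ?_⟩
  obtain ⟨x, ⟨k, rfl⟩, hx⟩ := happ n
  by_cases hk : AgreeUpTo n (shiftn a k) m
  · exact hk.symm.trans hx
  · have hsa := h.le_congr ((htails k).resolve_left hk) hk hx ham.symm
    exact h.antisymm hsa (hs.1 a (self_mem_tails a)) ▸ ham.symm

end IsCylOrder

/-- For every cylinder order `≤` on `A^∞`, `M_≤` equals the closure of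
`{s_≤(a) : a purely periodic}`; in particular `M_≤` is closed. -/
theorem stmt_1 {A : Type*} [Fintype A] [DecidableEq A]
    (le : (ℕ → A) → (ℕ → A) → Prop) (h : IsCylOrder le) :
    supWords le = wClosure {m | ∃ a, PurelyPeriodic a ∧ IsSupOf le (tails a) m} ∧
      wClosure (supWords le) = supWords le := by
  refine ⟨h.supWords_subset_wClosure.antisymm ?_, h.wClosure_supWords⟩
  refine (wClosure_mono ?_).trans h.wClosure_supWords.subset
  rintro m ⟨a, -, ha⟩
  exact ⟨a, ha⟩
end
end

section
/- Let ≤ be a cylinder order on {0,1}^∞ with [0] < [1]. If [10^j 1] < [10^j 0] holds for at most one j ≥ 0, then m_≤ = 10^∞, and every a ∈ M_≤ with a < m_≤ satisfies a = 0^∞ or a = (10^j)^∞ for the unique j ≥ 0 with [10^j 1] < [10^j 0] (if such j exists). -/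
open scoped Classical

noncomputable section

/-- Infinite binary words. -/
abbrev W2 := ℕ → Bool

/-- The word `0^∞`. -/
def w0 : W2 := fun _ => false

/-- The word `1^∞`. -/
def w1 : W2 := fun _ => true

/-- The word `10^∞`. -/
def w10inf : W2 := fun n => decide (n = 0)

/-- The periodic word `w^∞` for a finite word `w`. -/
def perW (w : List Bool) : W2 := fun n => w.getD (n % w.length) false

/-- A substitution on `{0,1}`, given by the images of the two letters. -/
abbrev Sub2 := Bool → List Bool

/-- Action of a substitution on finite words. -/
def listApply (f : Sub2) (l : List Bool) : List Bool := (l.map f).flatten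

/-- Action of a (nonerasing) substitution on infinite words. -/
def subApply (f : Sub2) (a : W2) : W2 :=
  fun n => (listApply f (List.ofFn (fun i : Fin (n + 1) => a i.val))).getD n false

/-- The substitution `τ_{j,k} : 0 ↦ 10^j, 1 ↦ 10^k`. -/
def tauS (j k : ℕ) : Sub2 := fun b => true :: List.replicate (if b then k else j) false

/-- Membership in the set `S = {τ_{j,k} : 0 ≤ j < k}`. -/
def memS (f : Sub2) : Prop := ∃ j k : ℕ, j < k ∧ f = tauS j k

/-- Apply a finite composition `σ_1 ∘ ⋯ ∘ σ_n` (given as a list) to an infinite word. -/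
def applyList (L : List Sub2) (a : W2) : W2 := L.foldr subApply a

/-- Apply a finite composition `σ_1 ∘ ⋯ ∘ σ_n` (given as a list) to a finite word. -/
def listApplyL (L : List Sub2) (l : List Bool) : List Bool := L.foldr listApply l

/-- `σ_{[1,n]} = σ_1 ∘ ⋯ ∘ σ_n` applied to an infinite word, for `σ ∈ S^∞`
(indexed from 0 in Lean). -/
def compUpTo (σ : ℕ → Sub2) (n : ℕ) (a : W2) : W2 :=
  applyList (List.ofFn (fun i : Fin n => σ i.val)) a

/-- `m` is the limit word `lim_{n → ∞} σ_{[1,n]}(a)`. -/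
def IsLimitWord (σ : ℕ → Sub2) (a m : W2) : Prop :=
  ∀ ε : ℝ, 0 < ε → ∃ N : ℕ, ∀ n ≥ N, wdist (compUpTo σ n a) m < ε

/-- The finite word `10^j b`. -/
def wordTenJ (j : ℕ) (b : Bool) : List Bool := true :: (List.replicate j false ++ [b])

section WordMetric

variable {A : Type*} [DecidableEq A]

theorem wdist_pos {a b : ℕ → A} (hab : a ≠ b) : 0 < wdist a b := by
  unfold wdist
  rw [dif_pos (Function.ne_iff.mp hab)]
  positivity

theorem wdist_le_of_agree {a b : ℕ → A} {n : ℕ} (hab : ∀ i < n, a i = b i) :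
    wdist a b ≤ (2 : ℝ)⁻¹ ^ (n + 1) := by
  unfold wdist
  split_ifs with h
  · refine pow_le_pow_of_le_one (by norm_num) (by norm_num) ?_
    have : n ≤ Nat.find h := by
      by_contra! hlt
      exact Nat.find_spec h (hab _ hlt)
    omega
  · positivity

theorem le_wdist_of_ne {a b : ℕ → A} {n : ℕ} (hab : a n ≠ b n) :
    (2 : ℝ)⁻¹ ^ (n + 1) ≤ wdist a b := by
  unfold wdist
  rw [dif_pos ⟨n, hab⟩]
  refine pow_le_pow_of_le_one (by norm_num) (by norm_num) ?_
  exact Nat.succ_le_succ (Nat.find_min' _ hab)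

/-- A pair of words that agree beyond position `n` is closer than a pair that differs at `n`. -/
theorem wdist_lt_of_agree {a b c d : ℕ → A} {n : ℕ} (hab : ∀ i ≤ n, a i = b i)
    (hcd : c n ≠ d n) : wdist a b < wdist c d :=
  calc wdist a b ≤ (2 : ℝ)⁻¹ ^ (n + 1 + 1) := wdist_le_of_agree fun i hi => hab i (by omega)
    _ < (2 : ℝ)⁻¹ ^ (n + 1) :=
      pow_lt_pow_right_of_lt_one₀ (by norm_num) (by norm_num) (by omega)
    _ ≤ wdist c d := le_wdist_of_ne hcd

theorem exists_pos_wdist_lt_imp_eq (y p : ℕ → A) :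
    ∃ ε : ℝ, 0 < ε ∧ ∀ z, wdist y z < ε → z = p → z = y := by
  by_cases hp : y = p
  · exact ⟨1, one_pos, fun z _ hz => hz.trans hp.symm⟩
  · exact ⟨wdist y p, wdist_pos hp, fun z hlt hz => absurd hlt (by simp [hz])⟩

end WordMetric

theorem inCyl_wordTenJ {k : ℕ} {b : Bool} {x : W2} :
    inCyl (wordTenJ k b) x ↔
      x 0 = true ∧ (∀ i < k, x (i + 1) = false) ∧ x (k + 1) = b := by
  have hlen : (wordTenJ k b).length = k + 2 := by simp [wordTenJ]
  constructor
  · intro hx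
    refine ⟨?_, fun i hi => ?_, ?_⟩
    · simpa [wordTenJ] using hx ⟨0, by omega⟩
    · have := hx ⟨i + 1, by omega⟩
      simpa [wordTenJ, List.getElem_append, hi] using this
    · have := hx ⟨k + 1, by omega⟩
      simpa [wordTenJ] using this
  · rintro ⟨h0, h1, h2⟩ ⟨i, hi⟩
    rcases i with _ | i
    · simpa [wordTenJ] using h0
    · rcases Nat.lt_or_ge i k with hik | hik
      · simpa [wordTenJ, List.getElem_append, hik] using h1 i hik
      · obtain rfl : i = k := by omega
        simpa [wordTenJ] using h2

theorem perW_ten (k n : ℕ) :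
    perW (true :: List.replicate k false) n = decide (n % (k + 1) = 0) := by
  unfold perW
  simp only [List.length_cons, List.length_replicate]
  have hlt : n % (k + 1) < k + 1 := Nat.mod_lt _ (by omega)
  rcases hr : n % (k + 1) with _ | r
  · simp
  · simp [List.getD_eq_getElem?_getD, List.getElem?_replicate]
    split_ifs <;> rfl

section CylOrder

variable {le : W2 → W2 → Prop}

/-- A word in `[1]` below `10^∞` lies in a cylinder `[10^k 1]` with `[10^k 1] < [10^k 0]`. -/
theorem exists_cylLt_of_wlt_w10inf (h : IsCylOrder le) {x : W2} (hx0 : x 0 = true)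
    (hx : wlt le x w10inf) :
    ∃ k, cylLt le (wordTenJ k true) (wordTenJ k false) ∧ inCyl (wordTenJ k true) x := by
  obtain ⟨htot, hanti, htrans, hcyl⟩ := h
  obtain ⟨hle, hne⟩ := hx
  have hex : ∃ k, x (k + 1) = true := by
    by_contra! hno
    refine hne (funext fun n => ?_)
    rcases n with _ | n
    · simpa [w10inf] using hx0
    · simpa [w10inf] using hno n
  let k := Nat.find hex
  have hk : x (k + 1) = true := Nat.find_spec hex
  have hmin : ∀ i < k, x (i + 1) = false := fun i hi => by
    simpa using Nat.find_min hex hi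
  refine ⟨k, ?_, inCyl_wordTenJ.mpr ⟨hx0, hmin, hk⟩⟩
  intro a b ha hb
  obtain ⟨ha0, ha1, ha2⟩ := inCyl_wordTenJ.mp ha
  obtain ⟨hb0, hb1, hb2⟩ := inCyl_wordTenJ.mp hb
  have hay : le a w10inf := by
    refine (htot _ _).resolve_right fun hya => ?_
    refine absurd (hcyl _ _ _ hle hya) (not_le.mpr (wdist_lt_of_agree (n := k + 1) ?_ ?_))
    · intro i hi
      rcases i with _ | i
      · rw [hx0, ha0]
      · rcases Nat.lt_or_ge i k with hik | hik
        · rw [hmin i hik, ha1 i hik]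
        · obtain rfl : i = k := by omega
          rw [hk, ha2]
    · simp [hk, w10inf]
  have hab : a (k + 1) ≠ b (k + 1) := by simp [ha2, hb2]
  refine ⟨(htot _ _).resolve_right fun hba => ?_, fun he => hab (by rw [he])⟩
  refine absurd (hcyl _ _ _ hba hay) (not_le.mpr (wdist_lt_of_agree (n := k + 1) ?_ hab.symm))
  intro i hi
  rcases i with _ | i
  · simp [hb0, w10inf]
  · rcases Nat.lt_or_ge i k with hik | hik
    · simp [hb1 i hik, w10inf]
    · obtain rfl : i = k := by omega
      simp [hb2, w10inf]

theorem wlt_of_head (h01 : cylLt le [false] [true]) {a b : W2} (ha : a 0 = false)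
    (hb : b 0 = true) : wlt le a b :=
  h01 a b (fun ⟨i, hi⟩ => by obtain rfl := Nat.lt_one_iff.mp hi; exact ha)
    (fun ⟨i, hi⟩ => by obtain rfl := Nat.lt_one_iff.mp hi; exact hb)

/-- If all tails of `a` in `[1]` coincide with the word `p` in `[1]`, and there is such a tail,
then `p` is the supremum of the tails of `a`. -/
theorem isSupOf_tails (h : IsCylOrder le) (h01 : cylLt le [false] [true]) {a p : W2}
    (hp : p 0 = true) {i : ℕ} (hi : a i = true)
    (htail : ∀ i, a i = true → shiftn a i = p) : IsSupOf le (tails a) p := by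
  refine ⟨?_, fun b hb => hb p ⟨i, (htail i hi).symm⟩⟩
  rintro _ ⟨n, rfl⟩
  cases hn : a n
  · exact (wlt_of_head h01 (by simpa [shiftn] using hn) hp).1
  · rw [htail n hn]
    exact (h.1 p p).elim id id

theorem perW_ten_mem_supWords (h : IsCylOrder le) (h01 : cylLt le [false] [true]) (k : ℕ) :
    perW (true :: List.replicate k false) ∈ supWords le := by
  have hp : perW (true :: List.replicate k false) 0 = true := by simp [perW_ten]
  refine ⟨_, isSupOf_tails h h01 hp hp fun i hi => ?_⟩
  rw [perW_ten, decide_eq_true_iff] at hi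
  funext n
  simp [shiftn, perW_ten, Nat.add_mod, hi]

/-- If every tail of `a` in `[1]` lies in `[10^k 1]`, then every such tail is `(10^k)^∞`. -/
theorem shiftn_eq_perW_ten {a : W2} {k : ℕ}
    (hcyl : ∀ i, a i = true → inCyl (wordTenJ k true) (shiftn a i)) :
    ∀ i, a i = true → shiftn a i = perW (true :: List.replicate k false) := by
  suffices ∀ n i, a i = true → a (n + i) = decide (n % (k + 1) = 0) from
    fun i hi => funext fun n => by rw [perW_ten]; exact this n i hi
  intro n
  induction n using Nat.strong_induction_on with
  | _ n ih =>
    intro i hi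
    obtain ⟨-, h1, h2⟩ := inCyl_wordTenJ.mp (hcyl i hi)
    simp only [shiftn] at h1 h2
    rcases Nat.lt_or_ge n (k + 1) with hn | hn
    · rw [Nat.mod_eq_of_lt hn]
      rcases n with _ | n
      · simpa using hi
      · simpa using h1 n (by omega)
    · have := ih (n - (k + 1)) (by omega) _ h2
      rwa [show n - (k + 1) + (k + 1 + i) = n + i by omega, ← Nat.mod_eq_sub_mod hn] at this

theorem eq_of_mem_supWords_of_wlt_w10inf (h : IsCylOrder le) (h01 : cylLt le [false] [true])
    (hatmost : ∀ j j' : ℕ, cylLt le (wordTenJ j true) (wordTenJ j false) →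
      cylLt le (wordTenJ j' true) (wordTenJ j' false) → j = j')
    {m : W2} (hm : m ∈ supWords le) (hlt : wlt le m w10inf) :
    m = w0 ∨ ∃ j : ℕ, cylLt le (wordTenJ j true) (wordTenJ j false) ∧
      m = perW (true :: List.replicate j false) := by
  obtain ⟨a, ha⟩ := hm
  have huniq : ∀ p, IsSupOf le (tails a) p → m = p := fun p hp =>
    h.2.1 _ _ (ha.2 _ hp.1) (hp.2 _ ha.1)
  by_cases hex : ∃ i, a i = true
  · right
    obtain ⟨i, hi⟩ := hex
    have htail : ∀ n, a n = true → ∃ k, cylLt le (wordTenJ k true) (wordTenJ k false) ∧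
        inCyl (wordTenJ k true) (shiftn a n) := fun n hn => by
      have hnm : le (shiftn a n) m := ha.1 _ ⟨n, rfl⟩
      refine exists_cylLt_of_wlt_w10inf h (by simpa [shiftn] using hn)
        ⟨h.2.2.1 _ _ _ hnm hlt.1, fun he => hlt.2 (h.2.1 _ _ hlt.1 (he ▸ hnm))⟩
    obtain ⟨k, hk, -⟩ := htail i hi
    refine ⟨k, hk, huniq _ (isSupOf_tails h h01 (by simp [perW_ten]) hi
      (shiftn_eq_perW_ten fun n hn => ?_))⟩
    obtain ⟨k', hk', hmem⟩ := htail n hn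
    exact hatmost k' k hk' hk ▸ hmem
  · left
    have hall : ∀ n, shiftn a n = w0 := fun n => funext fun i => by
      simpa [shiftn, w0] using not_exists.mp hex (i + n)
    refine huniq _ ⟨?_, fun b hb => hb _ ⟨0, (hall 0).symm⟩⟩
    rintro _ ⟨n, rfl⟩
    rw [hall]
    exact (h.1 _ _).elim id id

theorem w10inf_isAccPt (h : IsCylOrder le) (h01 : cylLt le [false] [true]) :
    IsAccPt' (supWords le) w10inf := by
  intro ε hε
  obtain ⟨k, hk⟩ := exists_pow_lt_of_lt_one hε (show (2 : ℝ)⁻¹ < 1 by norm_num)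
  refine ⟨_, perW_ten_mem_supWords h h01 k, fun he => ?_, lt_of_le_of_lt ?_ hk⟩
  · simpa [perW_ten, w10inf] using congrFun he (k + 1)
  · refine (wdist_le_of_agree (n := k + 1) fun i hi => ?_).trans
      (pow_le_pow_of_le_one (by norm_num) (by norm_num) (by omega))
    rw [perW_ten, Nat.mod_eq_of_lt hi, w10inf]

end CylOrder

/-- Let `≤` be a cylinder order on `{0,1}^∞` with `[0] < [1]`.
If `[10^j 1] < [10^j 0]` holds for at most one `j ≥ 0`, then `m_≤ = 10^∞`, and every
`a ∈ M_≤` with `a < m_≤` is `0^∞` or `(10^j)^∞` for the unique such `j` (if it exists). -/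
theorem stmt_3 (le : W2 → W2 → Prop) (h : IsCylOrder le)
    (h01 : cylLt le [false] [true])
    (hatmost : ∀ j j' : ℕ, cylLt le (wordTenJ j true) (wordTenJ j false) →
      cylLt le (wordTenJ j' true) (wordTenJ j' false) → j = j') :
    IsSmallestAcc le (supWords le) w10inf ∧
      ∀ a ∈ supWords le, wlt le a w10inf →
        a = w0 ∨ ∃ j : ℕ, cylLt le (wordTenJ j true) (wordTenJ j false) ∧
          a = perW (true :: List.replicate j false) := by
  have key := fun a ha => eq_of_mem_supWords_of_wlt_w10inf (m := a) h h01 hatmost ha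
  refine ⟨⟨w10inf_isAccPt h h01, fun y hy => ?_⟩, key⟩
  by_contra hnle
  have hylt : wlt le y w10inf :=
    ⟨(h.1 _ _).resolve_right hnle, fun he => hnle (he ▸ (h.1 y y).elim id id)⟩
  obtain ⟨p, hp⟩ : ∃ p, ∀ z ∈ supWords le, wlt le z w10inf → z = w0 ∨ z = p := by
    by_cases hj : ∃ j, cylLt le (wordTenJ j true) (wordTenJ j false)
    · obtain ⟨j, hj⟩ := hj
      refine ⟨perW (true :: List.replicate j false), fun z hz hzlt => ?_⟩
      refine (key z hz hzlt).imp_right ?_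
      rintro ⟨j', hj', rfl⟩
      rw [hatmost j' j hj' hj]
    · exact ⟨w0, fun z hz hzlt => Or.inl ((key z hz hzlt).resolve_right
        fun ⟨j, hj', _⟩ => hj ⟨j, hj'⟩)⟩
  obtain ⟨ε₀, hε₀, h₀⟩ := exists_pos_wdist_lt_imp_eq y w0
  obtain ⟨ε₁, hε₁, h₁⟩ := exists_pos_wdist_lt_imp_eq y p
  obtain ⟨z, hz, hzy, hd⟩ := hy (min (wdist y w10inf) (min ε₀ ε₁))
    (lt_min (wdist_pos hylt.2) (lt_min hε₀ hε₁))
  obtain ⟨hd, hd₀, hd₁⟩ := by simpa only [lt_min_iff] using hd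
  have hnot : ¬ le w10inf z := fun hle => not_le.mpr hd (h.2.2.2 _ _ _ hylt.1 hle)
  have hzlt : wlt le z w10inf :=
    ⟨(h.1 _ _).resolve_right hnot, fun he => hnot (he ▸ (h.1 z z).elim id id)⟩
  exact (hp z hz hzlt).elim (fun he => hzy (h₀ z hd₀ he)) (fun he => hzy (h₁ z hd₁ he))
end
end

section
/- Let σ = (σ_n)_{n≥1} ∈ S^∞ and set w_n := σ_{[1,n]}(0) σ_{[1,n−1]}(0) ⋯ σ_{[1,1]}(0) for n ≥ 1 and w_0 := ε (the empty word). Then for all even n ≥ 0: σ_{[1,n]}([0]) ⊆ [w_n 0] and σ_{[1,n]}([1]) ⊆ [w_n 1]; and for all odd n ≥ 1: σ_{[1,n]}([0]) ⊆ [w_n 1] and σ_{[1,n]}([1]) ⊆ [w_n 0]. -/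
open scoped Classical

noncomputable section

/-- The finite word `w_n = σ_{[1,n]}(0) σ_{[1,n-1]}(0) ⋯ σ_{[1,1]}(0)`, with `w_0 = ε`. -/
def prefWord (σ : ℕ → Sub2) : ℕ → List Bool
  | 0 => []
  | n + 1 => listApplyL (List.ofFn (fun i : Fin (n + 1) => σ i.val)) [false] ++ prefWord σ n

/-- The concatenation of a finite word and an infinite word. -/
def wappend (u : List Bool) (a : W2) : W2 := fun n => u.getD n (a (n - u.length))

theorem wappend_nil (a : W2) : wappend [] a = a := by
  funext n
  simp [wappend]

theorem wappend_append (u v : List Bool) (a : W2) :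
    wappend (u ++ v) a = wappend u (wappend v a) := by
  funext n
  rcases lt_or_ge n u.length with h | h
  · simp [wappend, List.getElem?_append_left h, List.getElem?_eq_getElem h]
  · simp [wappend, List.getElem?_append_right h, List.getElem?_eq_none h, Nat.sub_sub]

theorem wappend_head_shiftn (a : W2) : wappend [a 0] (shiftn a 1) = a := by
  funext n
  cases n <;> simp [wappend, shiftn]

theorem inCyl_append_wappend {u v : List Bool} {a : W2} (h : inCyl v a) :
    inCyl (u ++ v) (wappend u a) := by
  rintro ⟨i, hi⟩
  rw [List.length_append] at hi
  rcases lt_or_ge i u.length with hu | hu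
  · simp [wappend, List.getElem_append_left hu, List.getElem?_eq_getElem hu]
  · have := h ⟨i - u.length, by omega⟩
    simpa [wappend, List.getElem_append_right hu, List.getElem?_eq_none hu] using this

theorem listApply_append (f : Sub2) (u v : List Bool) :
    listApply f (u ++ v) = listApply f u ++ listApply f v := by
  simp [listApply]

theorem listApply_cons (f : Sub2) (c : Bool) (u : List Bool) :
    listApply f (c :: u) = f c ++ listApply f u := by
  simp [listApply]

theorem length_le_length_listApply {f : Sub2} (hf : ∀ c, f c ≠ []) (u : List Bool) :
    u.length ≤ (listApply f u).length := by
  induction u with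
  | nil => simp
  | cons c u ih =>
    have := List.length_pos_of_ne_nil (hf c)
    rw [listApply_cons, List.length_append, List.length_cons]
    omega

/-- Any sufficiently long prefix of `a` determines the letter of `subApply f a` at position `n`. -/
theorem subApply_eq_getD {f : Sub2} (hf : ∀ c, f c ≠ []) (a : W2) {n m : ℕ} (h : n < m) :
    subApply f a n = (listApply f (List.ofFn (fun i : Fin m => a i.val))).getD n false := by
  obtain ⟨d, rfl⟩ := Nat.exists_eq_add_of_lt h
  have hlen := length_le_length_listApply hf (List.ofFn (fun i : Fin (n + 1) => a i.val))
  rw [List.length_ofFn] at hlen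
  rw [show n + d + 1 = n + 1 + d by omega, List.ofFn_add, listApply_append,
    List.getD_append _ _ _ _ (by simpa using hlen)]
  rfl

theorem subApply_wappend_singleton {f : Sub2} (hf : ∀ c, f c ≠ []) (c : Bool) (a : W2) :
    subApply f (wappend [c] a) = wappend (f c) (subApply f a) := by
  funext n
  have hpos := List.length_pos_of_ne_nil (hf c)
  have hofFn : List.ofFn (fun i : Fin (n + 1) => wappend [c] a i.val) =
      c :: List.ofFn (fun i : Fin n => a i.val) := by
    simp [List.ofFn_succ, wappend]
  rw [subApply, hofFn, listApply_cons]
  rcases lt_or_ge n (f c).length with h | h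
  · rw [List.getD_append _ _ _ _ h]
    simp [wappend, List.getElem?_eq_getElem h]
  · rw [List.getD_append_right _ _ _ _ h,
      ← subApply_eq_getD hf a (show n - (f c).length < n by omega)]
    simp [wappend, List.getElem?_eq_none h]

theorem subApply_wappend {f : Sub2} (hf : ∀ c, f c ≠ []) (u : List Bool) (a : W2) :
    subApply f (wappend u a) = wappend (listApply f u) (subApply f a) := by
  induction u with
  | nil => simp [listApply, wappend_nil]
  | cons c u ih =>
    rw [← List.singleton_append, wappend_append, subApply_wappend_singleton hf, ih,
      ← wappend_append, List.singleton_append, listApply_cons]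

theorem applyList_wappend {L : List Sub2} (hL : ∀ f ∈ L, ∀ c, f c ≠ []) (u : List Bool) (a : W2) :
    applyList L (wappend u a) = wappend (listApplyL L u) (applyList L a) := by
  induction L with
  | nil => rfl
  | cons f L ih =>
    rw [List.forall_mem_cons] at hL
    have := ih hL.2
    simp only [applyList, listApplyL, List.foldr_cons] at this ⊢
    rw [this, subApply_wappend hL.1]

theorem memS.ne_nil {f : Sub2} (hf : memS f) (c : Bool) : f c ≠ [] := by
  obtain ⟨j, k, -, rfl⟩ := hf
  simp [tauS]

/-- The image of an infinite word under `f ∈ S` is `f(0)` followed by a word whose first letter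
is opposite to that of the original word. -/
theorem memS.exists_subApply_eq {f : Sub2} (hf : memS f) (a : W2) :
    ∃ b : W2, b 0 = !a 0 ∧ subApply f a = wappend (f false) b := by
  have key := subApply_wappend_singleton hf.ne_nil (a 0) (shiftn a 1)
  rw [wappend_head_shiftn] at key
  obtain ⟨j, k, hjk, rfl⟩ := hf
  cases ha : a 0 with
  | false =>
    rw [ha] at key
    exact ⟨_, by simp [subApply, listApply, tauS], key⟩
  | true =>
    rw [ha] at key
    have hsplit : tauS j k true = tauS j k false ++ List.replicate (k - j) false := by
      simp [tauS, Nat.add_sub_cancel' hjk.le]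
    rw [hsplit, wappend_append] at key
    exact ⟨_, by simp [wappend, Nat.sub_pos_of_lt hjk], key⟩

theorem ofFn_comp_succ (σ : ℕ → Sub2) (n : ℕ) :
    List.ofFn (fun i : Fin (n + 1) => σ i.val) =
      List.ofFn (fun i : Fin n => σ i.val) ++ [σ n] := by
  rw [List.ofFn_succ', List.concat_eq_append]
  rfl

theorem inCyl_prefWord_compUpTo (σ : ℕ → Sub2) (hσ : ∀ n, memS (σ n)) (n : ℕ) (a : W2) :
    inCyl (prefWord σ n ++ [if Even n then a 0 else !a 0]) (compUpTo σ n a) := by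
  induction n generalizing a with
  | zero =>
    rintro ⟨i, hi⟩
    obtain rfl : i = 0 := by simpa [prefWord] using hi
    simp [prefWord, compUpTo, applyList]
  | succ n ih =>
    obtain ⟨b, hb, hab⟩ := (hσ n).exists_subApply_eq a
    have hne : ∀ f ∈ List.ofFn (fun i : Fin n => σ i.val), ∀ c, f c ≠ [] := by
      intro f hf
      obtain ⟨i, rfl⟩ := (List.mem_ofFn' _ _).1 hf
      exact (hσ i).ne_nil
    have hcomp : compUpTo σ (n + 1) a =
        wappend (listApplyL (List.ofFn (fun i : Fin (n + 1) => σ i.val)) [false])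
          (compUpTo σ n b) := by
      have := applyList_wappend hne (σ n false) b
      rw [compUpTo, compUpTo, ofFn_comp_succ]
      simpa [applyList, listApplyL, listApply, hab] using this
    have hletter : (if Even (n + 1) then a 0 else !a 0) = if Even n then b 0 else !b 0 := by
      by_cases hn : Even n <;> simp [hn, hb, Nat.even_add_one]
    rw [hcomp, prefWord, List.append_assoc, hletter]
    exact inCyl_append_wappend (ih b)

/-- For `σ ∈ S^∞` and `w_n = σ_{[1,n]}(0) ⋯ σ_{[1,1]}(0)`:
for even `n`, `σ_{[1,n]}([0]) ⊆ [w_n 0]` and `σ_{[1,n]}([1]) ⊆ [w_n 1]`;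
for odd `n`, `σ_{[1,n]}([0]) ⊆ [w_n 1]` and `σ_{[1,n]}([1]) ⊆ [w_n 0]`. -/
theorem stmt_5 (σ : ℕ → Sub2) (hσ : ∀ n, memS (σ n)) (n : ℕ) :
    (Even n →
      (∀ a : W2, a 0 = false → inCyl (prefWord σ n ++ [false]) (compUpTo σ n a)) ∧
      (∀ a : W2, a 0 = true → inCyl (prefWord σ n ++ [true]) (compUpTo σ n a))) ∧
    (Odd n →
      (∀ a : W2, a 0 = false → inCyl (prefWord σ n ++ [true]) (compUpTo σ n a)) ∧
      (∀ a : W2, a 0 = true → inCyl (prefWord σ n ++ [false]) (compUpTo σ n a))) := by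
  have key := inCyl_prefWord_compUpTo σ hσ n
  refine ⟨fun hn => ⟨fun a ha => ?_, fun a ha => ?_⟩, fun hn => ⟨fun a ha => ?_, fun a ha => ?_⟩⟩
  · simpa only [hn, if_true, ha] using key a
  · simpa only [hn, if_true, ha] using key a
  · simpa only [Nat.not_even_iff_odd.2 hn, if_false, ha, Bool.not_false, Bool.not_true] using key a
  · simpa only [Nat.not_even_iff_odd.2 hn, if_false, ha, Bool.not_false, Bool.not_true] using key a
end
end
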